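/- Let (Ω, 𝓕, P) be a probability space, X : Ω → ℝ a random variable, d ≥ 1, and T_1, …, T_d : ℝ → ℝ strictly increasing functions. Define X_i := T_i ∘ X. Then for every (x_1, …, x_d) ∈ ℝ^d, P(X_1 ≤ x_1, X_2 ≤ x_2, …, X_d ≤ x_d) = min_{1 ≤ i ≤ d} P(X_i ≤ x_i). -/

import Mathlib

open MeasureTheory

/-- Comonotonicity under strictly increasing transformations (Appendix C): if
`Xᵢ = Tᵢ ∘ X` with each `Tᵢ` strictly increasing, then the joint CDF of
`(X₁, …, X_d)` is the minimum of the marginal CDFs. -/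
theorem stmt10 {Ω : Type*} [MeasurableSpace Ω] (P : Measure Ω) [IsProbabilityMeasure P]
    (X : Ω → ℝ) (d : ℕ) (hd : 1 ≤ d)
    (T : Fin d → ℝ → ℝ) (hT : ∀ i, StrictMono (T i)) (x : Fin d → ℝ) :
    (P {ω | ∀ i, T i (X ω) ≤ x i}).toReal = ⨅ i, (P {ω | T i (X ω) ≤ x i}).toReal := by
  haveI : Nonempty (Fin d) := ⟨⟨0, hd⟩⟩
  let D : Fin d → LowerSet ℝ := fun i =>
    ⟨{y | T i y ≤ x i}, fun _ _ hab ha => ((hT i).monotone hab).trans ha⟩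
  obtain ⟨j, hj⟩ := Finite.exists_min D
  have hsub : ∀ i y, T j y ≤ x j → T i y ≤ x i := fun i y hy => hj i hy
  apply le_antisymm
  · refine le_ciInf fun i => ?_
    exact ENNReal.toReal_mono (measure_ne_top _ _) (measure_mono fun ω hω => hω i)
  · refine (ciInf_le (Set.finite_range _).bddBelow j).trans ?_
    exact ENNReal.toReal_mono (measure_ne_top _ _)
      (measure_mono fun ω hω i => hsub i (X ω) hω)
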